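/- Let w ∈ W be an involution (w² = id) and let w′ = w̃ · s_{η_{k_1}+η_{k_2}} in W″. Then ℓ″(w′) = 2(k_2 − k_1 − 1) + 4·|w̃(A) ∩ A⁻| + 4·|w̃(A) ∩ B⁻| + 4·|C| + ℓ(w) + 1, where w̃(A) = {w̃(a) : a ∈ A}. -/

import Mathlib

/-!
The Weyl group of type `Dₙ`, realized as the group of permutations `w` of `ℤ`
supported on `{±1, …, ±n}` with `w (-i) = - w i` and an even number of sign changes.
-/

open Equiv

/-- The simple reflections of type `Dₙ`, indexed by `i ∈ {1, …, n}`: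
`sᵢ = (i, i+1)(-i, -(i+1))` for `1 ≤ i ≤ n - 1`, and
`sₙ = (n-1, -n)(-(n-1), n)`. -/
def simpleRefl (n : ℕ) (i : ℕ) : Equiv.Perm ℤ :=
  if i < n then Equiv.swap (i : ℤ) ((i : ℤ) + 1) * Equiv.swap (-(i : ℤ)) (-((i : ℤ) + 1))
  else Equiv.swap ((n : ℤ) - 1) (-(n : ℤ)) * Equiv.swap (-((n : ℤ) - 1)) (n : ℤ)

/-- A word in the letters `{1, …, n}` (indices of simple reflections). -/
def IsWord (n : ℕ) (L : List ℕ) : Prop := ∀ i ∈ L, 1 ≤ i ∧ i ≤ n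

/-- The product `s_{i₁} ⋯ s_{i_l}` of the word `L = [i₁, …, i_l]`. -/
def wordProd (n : ℕ) (L : List ℕ) : Equiv.Perm ℤ := (L.map (simpleRefl n)).prod

/-- Membership in the Weyl group `W` of type `Dₙ`: a permutation of `ℤ` commuting with
negation, fixing every integer of absolute value `> n`, and with an even number of
`i ∈ {1, …, n}` such that `w i < 0`. -/
def IsD (n : ℕ) (w : Equiv.Perm ℤ) : Prop :=
  (∀ i : ℤ, w (-i) = -(w i)) ∧ (∀ i : ℤ, (n : ℤ) < |i| → w i = i) ∧
    Even (((Finset.Icc (1 : ℤ) (n : ℤ)).filter fun i => w i < 0).card)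

/-- The length `ℓ(w)`: the minimal number of factors in an expression of `w` as a
product of simple reflections. -/
noncomputable def weylLength (n : ℕ) (w : Equiv.Perm ℤ) : ℕ :=
  sInf {l | ∃ L : List ℕ, IsWord n L ∧ L.length = l ∧ wordProd n L = w}

/-- `L` is a reduced decomposition of `w`. -/
def IsReducedWord (n : ℕ) (w : Equiv.Perm ℤ) (L : List ℕ) : Prop :=
  IsWord n L ∧ wordProd n L = w ∧ L.length = weylLength n w

/-- `w` is a basic involution: `w ∈ W`, `w² = id`, and `w i ≠ -i` for all `i ∈ {1, …, n}`. -/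
def IsBasicInvolution (n : ℕ) (w : Equiv.Perm ℤ) : Prop :=
  IsD n w ∧ w * w = 1 ∧ ∀ i : ℤ, 1 ≤ i → i ≤ (n : ℤ) → w i ≠ -i

/-- The increasing bijection `φ : {1, …, n} → {1, …, n+2} ∖ {k₁, k₂}`. -/
def phiMap (k1 k2 i : ℤ) : ℤ := if i ≤ k1 - 1 then i else if i ≤ k2 - 2 then i + 1 else i + 2

/-! ### Signed permutations and the number of inversions -/

/-- `w` commutes with negation and is supported on `{±1, …, ±n}`. -/
def IsSignedPerm (n : ℕ) (w : Equiv.Perm ℤ) : Prop :=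
  (∀ i : ℤ, w (-i) = -(w i)) ∧ ∀ i : ℤ, (n : ℤ) < |i| → w i = i

/-- The number of positive roots `η_i ± η_j` sent to negative roots, as a function of the
images `a`, `b` of `i < j`. -/
def pairInv (a b : ℤ) : ℤ := if b.natAbs < a.natAbs then 1 else if a < 0 then 2 else 0

/-- The number of positive roots of type `Dₙ` sent to negative roots by `w`. -/
noncomputable def dInv (n : ℕ) (w : Equiv.Perm ℤ) : ℤ :=
  ∑ p ∈ Finset.Icc (1 : ℤ) n, ∑ q ∈ Finset.Icc (1 : ℤ) n,
    if p < q then pairInv (w p) (w q) else 0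

/-- The reflection exchanging `x` with `y` and `-x` with `-y`. -/
def signedSwap (x y : ℤ) : Equiv.Perm ℤ := Equiv.swap x y * Equiv.swap (-x) (-y)

lemma signedSwap_apply {x y : ℤ} (hx : x ≠ 0) (hy : y ≠ 0) (hxy : x ≠ y) (hxy' : x ≠ -y) (p : ℤ) :
    signedSwap x y p = if p = x then y else if p = y then x else if p = -x then -y else
      if p = -y then -x else p := by
  simp only [signedSwap, Equiv.Perm.mul_apply, Equiv.swap_apply_def]
  split_ifs <;> omega

lemma signedSwap_mul_self {x y : ℤ} (hx : x ≠ 0) (hy : y ≠ 0) (hxy : x ≠ y) (hxy' : x ≠ -y) :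
    signedSwap x y * signedSwap x y = 1 := by
  ext p
  simp only [Equiv.Perm.mul_apply, signedSwap_apply hx hy hxy hxy', Equiv.Perm.one_apply]
  split_ifs <;> omega

namespace IsSignedPerm

variable {n : ℕ} {w v : Equiv.Perm ℤ}

lemma mul (hw : IsSignedPerm n w) (hv : IsSignedPerm n v) : IsSignedPerm n (w * v) :=
  ⟨fun i => by simp [hv.1, hw.1], fun i hi => by simp [hv.2 i hi, hw.2 i hi]⟩

lemma one : IsSignedPerm n 1 := ⟨fun _ => rfl, fun _ _ => rfl⟩

lemma map_zero (hw : IsSignedPerm n w) : w 0 = 0 := by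
  have := hw.1 0
  simp at this
  omega

lemma map_ne_zero (hw : IsSignedPerm n w) {i : ℤ} (hi : i ≠ 0) : w i ≠ 0 := fun h =>
  hi (w.injective (h.trans hw.map_zero.symm))

lemma natAbs_ne (hw : IsSignedPerm n w) {i j : ℤ} (h : i ≠ j) (h' : i ≠ -j) :
    (w i).natAbs ≠ (w j).natAbs := by
  intro e
  rcases Int.natAbs_eq_natAbs_iff.1 e with e | e
  · exact h (w.injective e)
  · exact h' (w.injective (e.trans (hw.1 j).symm))

lemma natAbs_le (hw : IsSignedPerm n w) {i : ℤ} (hi : i.natAbs ≤ n) : (w i).natAbs ≤ n := by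
  by_contra h
  have h1 : w (w i) = w i := hw.2 _ (by rw [Int.abs_eq_natAbs]; omega)
  have h2 : w i = i := w.injective h1
  rw [h2] at h
  omega

end IsSignedPerm

lemma isSignedPerm_signedSwap {n : ℕ} {x y : ℤ} (hx : x ≠ 0) (hy : y ≠ 0) (hxy : x ≠ y)
    (hxy' : x ≠ -y) (hxn : x.natAbs ≤ n) (hyn : y.natAbs ≤ n) :
    IsSignedPerm n (signedSwap x y) := by
  constructor
  · intro i
    rw [signedSwap_apply hx hy hxy hxy', signedSwap_apply hx hy hxy hxy']
    split_ifs <;> omega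
  · intro i hi
    rw [Int.abs_eq_natAbs] at hi
    rw [signedSwap_apply hx hy hxy hxy']
    split_ifs <;> omega

lemma IsD.isSignedPerm {n : ℕ} {w : Equiv.Perm ℤ} (hw : IsD n w) : IsSignedPerm n w :=
  ⟨hw.1, hw.2.1⟩

lemma sum_eq_sum_sdiff_pair (T : Finset ℤ) {x y : ℤ} (hx : x ∈ T) (hy : y ∈ T) (hxy : x ≠ y)
    {M : Type*} [AddCommMonoid M] (g : ℤ → M) :
    ∑ p ∈ T, g p = ∑ p ∈ T \ {x, y}, g p + (g x + g y) := by
  rw [← Finset.sum_pair hxy, Finset.sum_sdiff]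
  intro z hz
  simp only [Finset.mem_insert, Finset.mem_singleton] at hz
  rcases hz with rfl | rfl <;> assumption

lemma sum_sum_eq_sdiff_pair (T : Finset ℤ) {x y : ℤ} (hx : x ∈ T) (hy : y ∈ T) (hxy : x ≠ y)
    (g : ℤ → ℤ → ℤ) :
    ∑ p ∈ T, ∑ q ∈ T, g p q = ∑ p ∈ T \ {x, y}, ∑ q ∈ T \ {x, y}, g p q
      + ∑ p ∈ T \ {x, y}, (g p x + g p y + g x p + g y p)
      + (g x x + g x y + g y x + g y y) := by
  simp only [sum_eq_sum_sdiff_pair T hx hy hxy, Finset.sum_add_distrib]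
  ring

/-! ### The length equals the number of inversions -/

lemma dInv_eq_of_adjacent {n : ℕ} {w u : Equiv.Perm ℤ} {x : ℤ} (hx : 1 ≤ x) (hxn : x + 1 ≤ n)
    (hS : ∀ p : ℤ, 1 ≤ p → p ≤ n → p ≠ x → p ≠ x + 1 → u p = w p)
    (hmid : ∀ p : ℤ, 1 ≤ p → p < x →
      pairInv (w p) (u x) + pairInv (w p) (u (x + 1)) =
        pairInv (w p) (w x) + pairInv (w p) (w (x + 1)))
    (hmid' : ∀ p : ℤ, x + 1 < p → p ≤ n →
      pairInv (u x) (w p) + pairInv (u (x + 1)) (w p) =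
        pairInv (w x) (w p) + pairInv (w (x + 1)) (w p)) :
    dInv n u = dInv n w - pairInv (w x) (w (x + 1)) + pairInv (u x) (u (x + 1)) := by
  have hxT : x ∈ Finset.Icc (1 : ℤ) n := Finset.mem_Icc.2 ⟨hx, by omega⟩
  have hyT : x + 1 ∈ Finset.Icc (1 : ℤ) n := Finset.mem_Icc.2 ⟨by omega, hxn⟩
  have hS' : ∀ p ∈ Finset.Icc (1 : ℤ) n \ {x, x + 1}, u p = w p := by
    intro p hp
    simp only [Finset.mem_sdiff, Finset.mem_Icc, Finset.mem_insert, Finset.mem_singleton,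
      not_or] at hp
    exact hS p hp.1.1 hp.1.2 hp.2.1 hp.2.2
  unfold dInv
  rw [sum_sum_eq_sdiff_pair _ hxT hyT (by omega), sum_sum_eq_sdiff_pair _ hxT hyT (by omega)]
  have h1 : ∑ p ∈ Finset.Icc (1 : ℤ) n \ {x, x + 1}, ∑ q ∈ Finset.Icc (1 : ℤ) n \ {x, x + 1},
        (if p < q then pairInv (u p) (u q) else 0) =
      ∑ p ∈ Finset.Icc (1 : ℤ) n \ {x, x + 1}, ∑ q ∈ Finset.Icc (1 : ℤ) n \ {x, x + 1},
        (if p < q then pairInv (w p) (w q) else 0) :=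
    Finset.sum_congr rfl fun p hp => Finset.sum_congr rfl fun q hq => by
      rw [hS' p hp, hS' q hq]
  rw [h1]
  have h2 := Finset.sum_congr (rfl : Finset.Icc (1 : ℤ) n \ {x, x + 1} = _)
    (f := fun p => (if p < x then pairInv (u p) (u x) else 0)
      + (if p < x + 1 then pairInv (u p) (u (x + 1)) else 0)
      + (if x < p then pairInv (u x) (u p) else 0)
      + (if x + 1 < p then pairInv (u (x + 1)) (u p) else 0))
    (g := fun p => (if p < x then pairInv (w p) (w x) else 0)
      + (if p < x + 1 then pairInv (w p) (w (x + 1)) else 0)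
      + (if x < p then pairInv (w x) (w p) else 0)
      + (if x + 1 < p then pairInv (w (x + 1)) (w p) else 0)) (by
    intro p hp
    have hp' := hS' p hp
    simp only [Finset.mem_sdiff, Finset.mem_Icc, Finset.mem_insert, Finset.mem_singleton,
      not_or] at hp
    obtain ⟨⟨hp1, hp2⟩, hp3, hp4⟩ := hp
    simp only [hp']
    rcases lt_or_gt_of_ne hp3 with h | h
    · have := hmid p hp1 h
      rw [if_pos h, if_pos (by omega), if_neg (by omega), if_neg (by omega), if_pos h,
        if_pos (by omega), if_neg (by omega), if_neg (by omega)]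
      omega
    · have := hmid' p (by omega) hp2
      rw [if_neg (by omega), if_neg (by omega), if_pos h, if_pos (by omega), if_neg (by omega),
        if_neg (by omega), if_pos h, if_pos (by omega)]
      omega)
  rw [h2]
  simp only [lt_self_iff_false, if_false, show ¬ (x + 1 < x) by omega, show x < x + 1 by omega,
    if_true]
  ring

lemma mul_swap_succ_apply_left (w : Equiv.Perm ℤ) {x : ℤ} (hx : 1 ≤ x) :
    (w * signedSwap x (x + 1)) x = w (x + 1) := by
  rw [Equiv.Perm.mul_apply, signedSwap_apply (by omega) (by omega) (by omega) (by omega),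
    if_pos rfl]

lemma mul_swap_succ_apply_right (w : Equiv.Perm ℤ) {x : ℤ} (hx : 1 ≤ x) :
    (w * signedSwap x (x + 1)) (x + 1) = w x := by
  rw [Equiv.Perm.mul_apply, signedSwap_apply (by omega) (by omega) (by omega) (by omega),
    if_neg (by omega), if_pos rfl]

lemma mul_swap_succ_apply_of_ne (w : Equiv.Perm ℤ) {x p : ℤ} (hx : 1 ≤ x) (hp : 1 ≤ p)
    (h : p ≠ x) (h' : p ≠ x + 1) : (w * signedSwap x (x + 1)) p = w p := by
  rw [Equiv.Perm.mul_apply, signedSwap_apply (by omega) (by omega) (by omega) (by omega),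
    if_neg h, if_neg h', if_neg (by omega), if_neg (by omega)]

lemma dInv_mul_swap_succ {n : ℕ} (w : Equiv.Perm ℤ) {x : ℤ} (hx : 1 ≤ x) (hxn : x + 1 ≤ n) :
    dInv n (w * signedSwap x (x + 1)) =
      dInv n w - pairInv (w x) (w (x + 1)) + pairInv (w (x + 1)) (w x) := by
  have e1 := mul_swap_succ_apply_left w hx
  have e2 := mul_swap_succ_apply_right w hx
  rw [dInv_eq_of_adjacent (w := w) hx hxn, e1, e2]
  · exact fun p h1 _ h3 h4 => mul_swap_succ_apply_of_ne w hx h1 h3 h4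
  · intro p _ _
    rw [e1, e2, add_comm]
  · intro p _ _
    rw [e1, e2, add_comm]

/-- Multiplying on the right by `signedSwap x (-y)` exchanges the images of `x` and `y` up to
sign. -/
lemma IsSignedPerm.mul_swap_neg_apply_left {n : ℕ} {w : Equiv.Perm ℤ} (hw : IsSignedPerm n w)
    {x y : ℤ} (hx : 1 ≤ x) (hxy : x < y) : (w * signedSwap x (-y)) x = -w y := by
  rw [Equiv.Perm.mul_apply, signedSwap_apply (by omega) (by omega) (by omega) (by omega),
    if_pos rfl, hw.1]

lemma IsSignedPerm.mul_swap_neg_apply_right {n : ℕ} {w : Equiv.Perm ℤ} (hw : IsSignedPerm n w)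
    {x y : ℤ} (hx : 1 ≤ x) (hxy : x < y) : (w * signedSwap x (-y)) y = -w x := by
  rw [Equiv.Perm.mul_apply, signedSwap_apply (by omega) (by omega) (by omega) (by omega),
    if_neg (by omega), if_neg (by omega), if_neg (by omega), if_pos (by omega), hw.1]

lemma mul_swap_neg_apply_of_ne (w : Equiv.Perm ℤ) {x y p : ℤ} (hx : 1 ≤ x) (hxy : x < y)
    (hp : 1 ≤ p) (h : p ≠ x) (h' : p ≠ y) : (w * signedSwap x (-y)) p = w p := by
  rw [Equiv.Perm.mul_apply, signedSwap_apply (by omega) (by omega) (by omega) (by omega),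
    if_neg h, if_neg (by omega), if_neg (by omega), if_neg (by omega)]

lemma dInv_mul_swap_last {n : ℕ} (hn : 2 ≤ n) {w : Equiv.Perm ℤ} (hw : IsSignedPerm n w) :
    dInv n (w * signedSwap (n - 1) (-n)) =
      dInv n w - pairInv (w (n - 1)) (w n) + pairInv (-w n) (-w (n - 1)) := by
  have hx : (1 : ℤ) ≤ n - 1 := by omega
  have hxy : (n : ℤ) - 1 < n := by omega
  have e1 := hw.mul_swap_neg_apply_left hx hxy
  have e2 := hw.mul_swap_neg_apply_right hx hxy
  have key := dInv_eq_of_adjacent (n := n) (w := w) (u := w * signedSwap (n - 1) (-n)) hx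
    (by omega)
  rw [sub_add_cancel, e1, e2] at key
  apply key
  · exact fun p h1 _ h3 h4 => mul_swap_neg_apply_of_ne w hx hxy h1 h3 h4
  · intro p _ _
    simp only [pairInv, Int.natAbs_neg]
    rw [add_comm]
  · intro p _ _
    omega

lemma simpleRefl_of_lt {n i : ℕ} (hi : i < n) : simpleRefl n i = signedSwap i (i + 1) := by
  simp [simpleRefl, signedSwap, hi]

lemma simpleRefl_last (n : ℕ) : simpleRefl n n = signedSwap (n - 1) (-n) := by
  simp [simpleRefl, signedSwap]

lemma isSignedPerm_simpleRefl {n i : ℕ} (hn : 2 ≤ n) (h1 : 1 ≤ i) (hi : i ≤ n) :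
    IsSignedPerm n (simpleRefl n i) := by
  rcases hi.lt_or_eq with h | rfl
  · rw [simpleRefl_of_lt h]
    apply isSignedPerm_signedSwap <;> omega
  · rw [simpleRefl_last]
    apply isSignedPerm_signedSwap <;> omega

lemma simpleRefl_mul_self {n i : ℕ} (hn : 2 ≤ n) (h1 : 1 ≤ i) (hi : i ≤ n) :
    simpleRefl n i * simpleRefl n i = 1 := by
  rcases hi.lt_or_eq with h | rfl
  · rw [simpleRefl_of_lt h]
    apply signedSwap_mul_self <;> omega
  · rw [simpleRefl_last]
    apply signedSwap_mul_self <;> omega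

lemma dInv_mul_simpleRefl_le {n i : ℕ} (hn : 2 ≤ n) (h1 : 1 ≤ i) (hi : i ≤ n)
    {w : Equiv.Perm ℤ} (hw : IsSignedPerm n w) :
    dInv n (w * simpleRefl n i) ≤ dInv n w + 1 := by
  rcases hi.lt_or_eq with h | rfl
  · rw [simpleRefl_of_lt h, dInv_mul_swap_succ w (by omega) (by omega)]
    have := hw.natAbs_ne (i := i) (j := i + 1) (by omega) (by omega)
    simp only [pairInv]
    split_ifs <;> omega
  · rw [simpleRefl_last, dInv_mul_swap_last hn hw]
    have := hw.natAbs_ne (i := (i : ℤ) - 1) (j := i) (by omega) (by omega)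
    simp only [pairInv]
    split_ifs <;> omega

lemma dInv_one (n : ℕ) : dInv n 1 = 0 := by
  refine Finset.sum_eq_zero fun p hp => Finset.sum_eq_zero fun q hq => ?_
  rw [Finset.mem_Icc] at hp hq
  simp only [pairInv, Equiv.Perm.one_apply]
  split_ifs <;> omega

lemma dInv_nonneg (n : ℕ) (w : Equiv.Perm ℤ) : 0 ≤ dInv n w := by
  refine Finset.sum_nonneg fun p _ => Finset.sum_nonneg fun q _ => ?_
  simp only [pairInv]
  split_ifs <;> omega

lemma wordProd_append_singleton (n : ℕ) (L : List ℕ) (i : ℕ) :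
    wordProd n (L ++ [i]) = wordProd n L * simpleRefl n i := by
  simp [wordProd]

lemma isSignedPerm_and_dInv_wordProd_le {n : ℕ} (hn : 2 ≤ n) (L : List ℕ) (hL : IsWord n L) :
    IsSignedPerm n (wordProd n L) ∧ dInv n (wordProd n L) ≤ L.length := by
  induction L using List.reverseRecOn with
  | nil => simp [wordProd, dInv_one, IsSignedPerm.one]
  | append_singleton L i ih =>
    obtain ⟨h1, h2⟩ := ih fun j hj => hL j (by simp [hj])
    obtain ⟨hi1, hi2⟩ := hL i (by simp)
    rw [wordProd_append_singleton]
    refine ⟨h1.mul (isSignedPerm_simpleRefl hn hi1 hi2), ?_⟩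
    have := dInv_mul_simpleRefl_le hn hi1 hi2 h1
    simp only [List.length_append, List.length_singleton]
    push_cast
    omega

lemma card_filter_neg_eq {n : ℕ} {x y : ℤ} (hx : x ∈ Finset.Icc (1 : ℤ) n)
    (hy : y ∈ Finset.Icc (1 : ℤ) n) (hxy : x ≠ y) (w : Equiv.Perm ℤ) :
    ((Finset.Icc (1 : ℤ) n).filter fun i => w i < 0).card =
      ∑ p ∈ Finset.Icc (1 : ℤ) n \ {x, y}, (if w p < 0 then 1 else 0)
        + ((if w x < 0 then 1 else 0) + if w y < 0 then 1 else 0) := by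
  rw [Finset.card_filter, sum_eq_sum_sdiff_pair _ hx hy hxy]

lemma IsD.mul_swap_neg {n : ℕ} {x y : ℤ} (hx : 1 ≤ x) (hxy : x < y) (hy : y ≤ n)
    {w : Equiv.Perm ℤ} (hw : IsD n w) : IsD n (w * signedSwap x (-y)) := by
  have hB := hw.isSignedPerm.mul (isSignedPerm_signedSwap (n := n) (x := x) (y := -y) (by omega)
    (by omega) (by omega) (by omega) (by omega) (by omega))
  refine ⟨hB.1, hB.2, ?_⟩
  have hpar := hw.2.2
  have hxT : x ∈ Finset.Icc (1 : ℤ) n := Finset.mem_Icc.2 ⟨by omega, by omega⟩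
  have hyT : y ∈ Finset.Icc (1 : ℤ) n := Finset.mem_Icc.2 ⟨by omega, by omega⟩
  rw [card_filter_neg_eq hxT hyT hxy.ne] at hpar ⊢
  have e : ∑ p ∈ Finset.Icc (1 : ℤ) n \ {x, y}, (if (w * signedSwap x (-y)) p < 0 then 1 else 0) =
      ∑ p ∈ Finset.Icc (1 : ℤ) n \ {x, y}, (if w p < 0 then 1 else 0) := by
    refine Finset.sum_congr rfl fun p hp => ?_
    simp only [Finset.mem_sdiff, Finset.mem_Icc, Finset.mem_insert, Finset.mem_singleton,
      not_or] at hp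
    rw [mul_swap_neg_apply_of_ne w hx hxy hp.1.1 hp.2.1 hp.2.2]
  rw [e, hw.isSignedPerm.mul_swap_neg_apply_left hx hxy,
    hw.isSignedPerm.mul_swap_neg_apply_right hx hxy]
  have n1 := hw.isSignedPerm.map_ne_zero (i := x) (by omega)
  have n2 := hw.isSignedPerm.map_ne_zero (i := y) (by omega)
  rw [Nat.even_iff] at hpar ⊢
  split_ifs at hpar ⊢ <;> omega

lemma IsD.mul_simpleRefl {n i : ℕ} (hn : 2 ≤ n) (h1 : 1 ≤ i) (hi : i ≤ n)
    {w : Equiv.Perm ℤ} (hw : IsD n w) : IsD n (w * simpleRefl n i) := by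
  rcases hi.lt_or_eq with h | rfl
  · have hB := hw.isSignedPerm.mul (isSignedPerm_simpleRefl hn h1 hi)
    refine ⟨hB.1, hB.2, ?_⟩
    have hpar := hw.2.2
    have hi1 : (1 : ℤ) ≤ i := by omega
    have hx : (i : ℤ) ∈ Finset.Icc (1 : ℤ) n := Finset.mem_Icc.2 ⟨by omega, by omega⟩
    have hy : (i : ℤ) + 1 ∈ Finset.Icc (1 : ℤ) n := Finset.mem_Icc.2 ⟨by omega, by omega⟩
    rw [card_filter_neg_eq hx hy (by omega)] at hpar ⊢
    rw [simpleRefl_of_lt h]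
    have e : ∑ p ∈ Finset.Icc (1 : ℤ) n \ {(i : ℤ), (i : ℤ) + 1},
        (if (w * signedSwap i (i + 1)) p < 0 then 1 else 0) =
        ∑ p ∈ Finset.Icc (1 : ℤ) n \ {(i : ℤ), (i : ℤ) + 1}, (if w p < 0 then 1 else 0) := by
      refine Finset.sum_congr rfl fun p hp => ?_
      simp only [Finset.mem_sdiff, Finset.mem_Icc, Finset.mem_insert, Finset.mem_singleton,
        not_or] at hp
      rw [mul_swap_succ_apply_of_ne w hi1 hp.1.1 hp.2.1 hp.2.2]
    rw [e, mul_swap_succ_apply_left w hi1, mul_swap_succ_apply_right w hi1]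
    rwa [add_comm (if w ((i : ℤ) + 1) < 0 then 1 else 0)]
  · rw [simpleRefl_last]
    exact hw.mul_swap_neg (by omega) (by omega) le_rfl

/-- An element of `W` without descents is trivial. -/
lemma IsD.eq_one_of_no_descent {n : ℕ} (hn : 2 ≤ n) {w : Equiv.Perm ℤ} (hw : IsD n w)
    (h : ∀ i, 1 ≤ i → i ≤ n → dInv n w ≤ dInv n (w * simpleRefl n i)) : w = 1 := by
  have hB := hw.isSignedPerm
  have hsucc : ∀ i : ℕ, 1 ≤ i → i < n → 0 < w (i + 1) → 0 < w i ∧ w i < w (i + 1) := by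
    intro i h1 hi hpos
    have h2 := h i h1 hi.le
    rw [simpleRefl_of_lt hi, dInv_mul_swap_succ w (by omega) (by omega)] at h2
    have := hB.natAbs_ne (i := i) (j := i + 1) (by omega) (by omega)
    have := hB.map_ne_zero (i := i) (by omega)
    simp only [pairInv] at h2
    split_ifs at h2 <;> omega
  have hlast : 0 < w (n - 1) ∧ (w (n - 1)).natAbs < (w n).natAbs := by
    have h2 := h n (by omega) le_rfl
    have h3 := h (n - 1) (by omega) (by omega)
    rw [simpleRefl_last, dInv_mul_swap_last hn hB] at h2
    rw [simpleRefl_of_lt (by omega), dInv_mul_swap_succ w (by omega) (by omega)] at h3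
    have e : ((n - 1 : ℕ) : ℤ) = (n : ℤ) - 1 := by omega
    rw [e, sub_add_cancel] at h3
    have := hB.natAbs_ne (i := (n : ℤ) - 1) (j := n) (by omega) (by omega)
    have := hB.map_ne_zero (i := (n : ℤ) - 1) (by omega)
    have := hB.map_ne_zero (i := (n : ℤ)) (by omega)
    simp only [pairInv] at h2 h3
    split_ifs at h2 h3 <;> omega
  have hdown : ∀ k : ℕ, k + 2 ≤ n → 0 < w (n - 1 - k) ∧ w (n - 1 - k) ≤ n - 1 - k := by
    intro k
    induction k with
    | zero =>
      intro _
      have := hB.natAbs_le (i := n) (by omega)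
      simp only [Nat.cast_zero, sub_zero]
      omega
    | succ k ih =>
      intro hk
      obtain ⟨h1, h2⟩ := ih (by omega)
      have h3 := hsucc (n - 1 - (k + 1)) (by omega) (by omega)
      have e : ((n - 1 - (k + 1) : ℕ) : ℤ) = (n : ℤ) - 1 - (k + 1 : ℕ) := by omega
      have e' : (n : ℤ) - 1 - (k + 1 : ℕ) + 1 = n - 1 - k := by omega
      rw [e, e'] at h3
      have := h3 h1
      omega
  have hpos : ∀ i : ℤ, 1 ≤ i → i < n → 0 < w i ∧ w i ≤ i := by
    intro i h1 h2
    have := hdown (n - 1 - i).toNat (by omega)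
    have e : (n : ℤ) - 1 - ((n - 1 - i).toNat : ℤ) = i := by omega
    rwa [e] at this
  have hup : ∀ i : ℕ, 1 ≤ i → i < n → (i : ℤ) ≤ w i := by
    intro i h1
    induction i, h1 using Nat.le_induction with
    | base => intro h2; exact (hpos 1 le_rfl (by omega)).1
    | succ i h1 ih =>
      intro h2
      have h3 := hsucc i h1 (by omega) (hpos (i + 1) (by omega) (by omega)).1
      have := ih (by omega)
      push_cast
      omega
  have hfix : ∀ i : ℤ, 1 ≤ i → i < n → w i = i := by
    intro i h1 h2
    have h3 := hup i.toNat (by omega) (by omega)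
    rw [Int.toNat_of_nonneg (by omega)] at h3
    have := (hpos i h1 h2).2
    omega
  have hn' : (w n).natAbs = n := by
    have := hB.natAbs_le (i := n) (by omega)
    have := hfix (n - 1) (by omega) (by omega)
    omega
  have hnpos : 0 < w n := by
    by_contra hneg
    have hpar := hw.2.2
    have : ((Finset.Icc (1 : ℤ) n).filter fun i => w i < 0) = {(n : ℤ)} := by
      ext i
      simp only [Finset.mem_filter, Finset.mem_Icc, Finset.mem_singleton]
      constructor
      · rintro ⟨⟨h1, h2⟩, h3⟩
        by_contra hne
        have := hpos i h1 (by omega)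
        omega
      · rintro rfl
        omega
    rw [this] at hpar
    simp at hpar
  have hfix' : ∀ i : ℤ, 0 ≤ i → w i = i := by
    intro i hi
    rcases lt_trichotomy i n with h1 | h1 | h1
    · rcases hi.eq_or_lt with h2 | h2
      · rw [← h2, hB.map_zero]
      · exact hfix i (by omega) h1
    · rw [h1]
      omega
    · exact hB.2 i (by rwa [abs_of_nonneg hi])
  ext i
  rcases le_total 0 i with hi | hi
  · exact hfix' i hi
  · have h1 := hfix' (-i) (by omega)
    rw [hB.1] at h1
    rw [Equiv.Perm.one_apply]
    omega

lemma IsD.exists_word {n : ℕ} (hn : 2 ≤ n) {w : Equiv.Perm ℤ} (hw : IsD n w) :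
    ∃ L, IsWord n L ∧ (L.length : ℤ) ≤ dInv n w ∧ wordProd n L = w := by
  obtain ⟨m, hm⟩ := Int.eq_ofNat_of_zero_le (dInv_nonneg n w)
  induction m using Nat.strong_induction_on generalizing w with
  | _ m ih =>
    by_cases h : ∀ i, 1 ≤ i → i ≤ n → dInv n w ≤ dInv n (w * simpleRefl n i)
    · refine ⟨[], by simp [IsWord], by simpa using dInv_nonneg n w, ?_⟩
      rw [hw.eq_one_of_no_descent hn h]
      rfl
    · push Not at h
      obtain ⟨i, h1, hi, hlt⟩ := h
      obtain ⟨k, hk⟩ := Int.eq_ofNat_of_zero_le (dInv_nonneg n (w * simpleRefl n i))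
      obtain ⟨L, hL, hlen, hprod⟩ := ih k (by omega) (hw.mul_simpleRefl hn h1 hi) hk
      refine ⟨L ++ [i], ?_, ?_, ?_⟩
      · intro j hj
        rcases List.mem_append.1 hj with hj | hj
        · exact hL j hj
        · rw [List.mem_singleton.1 hj]
          exact ⟨h1, hi⟩
      · simp only [List.length_append, List.length_singleton]
        push_cast
        omega
      · rw [wordProd_append_singleton, hprod, mul_assoc, simpleRefl_mul_self hn h1 hi, mul_one]

theorem IsD.weylLength_eq {n : ℕ} (hn : 2 ≤ n) {w : Equiv.Perm ℤ} (hw : IsD n w) :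
    (weylLength n w : ℤ) = dInv n w := by
  obtain ⟨L, hL, hlen, hprod⟩ := hw.exists_word hn
  have hmem : L.length ∈ {l | ∃ L : List ℕ, IsWord n L ∧ L.length = l ∧ wordProd n L = w} :=
    ⟨L, hL, rfl, hprod⟩
  apply le_antisymm
  · exact le_trans (Int.ofNat_le.2 (Nat.sInf_le hmem)) hlen
  · obtain ⟨L', hL', hlen', hprod'⟩ := Nat.sInf_mem ⟨_, hmem⟩
    rw [weylLength, ← hlen', ← hprod']
    exact (isSignedPerm_and_dInv_wordProd_le hn L' hL').2

/-! ### Inserting two fixed points -/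

section PhiMap

variable {k1 k2 : ℤ}

lemma phiMap_strictMono (k1 k2 : ℤ) : StrictMono (phiMap k1 k2) := by
  intro i j h
  unfold phiMap
  split_ifs <;> omega

lemma one_le_phiMap {i : ℤ} (hi : 1 ≤ i) : 1 ≤ phiMap k1 k2 i := by
  unfold phiMap
  split_ifs <;> omega

lemma image_phiMap (hk1 : 1 ≤ k1) (hk12 : k1 < k2) {n : ℕ} (hk2 : k2 ≤ (n + 2 : ℕ)) :
    (Finset.Icc (1 : ℤ) n).image (phiMap k1 k2) = Finset.Icc (1 : ℤ) (n + 2 : ℕ) \ {k1, k2} := by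
  ext p
  simp only [Finset.mem_image, Finset.mem_Icc, Finset.mem_sdiff, Finset.mem_insert,
    Finset.mem_singleton, not_or]
  constructor
  · rintro ⟨i, ⟨h1, h2⟩, rfl⟩
    unfold phiMap
    split_ifs <;> omega
  · rintro ⟨⟨h1, h2⟩, h3, h4⟩
    refine ⟨if p < k1 then p else if p < k2 then p - 1 else p - 2, ?_, ?_⟩
    · split_ifs <;> omega
    · unfold phiMap
      split_ifs <;> omega

variable {n : ℕ} {w wt : Equiv.Perm ℤ}

lemma apply_phiMap_cases (hw : IsSignedPerm n w)
    (hcomp : ∀ i : ℤ, 1 ≤ i → i ≤ (n : ℤ) →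
      wt (phiMap k1 k2 i) = Int.sign (w i) * phiMap k1 k2 |w i|) {i : ℤ} (h1 : 1 ≤ i)
    (hi : i ≤ n) :
    (0 < w i ∧ w i ≤ n ∧ wt (phiMap k1 k2 i) = phiMap k1 k2 (w i)) ∨
      (w i < 0 ∧ -w i ≤ n ∧ wt (phiMap k1 k2 i) = -phiMap k1 k2 (-w i)) := by
  have h := hcomp i h1 hi
  have hle := hw.natAbs_le (i := i) (by omega)
  rcases lt_or_gt_of_ne (hw.map_ne_zero (i := i) (by omega)) with h0 | h0
  · right
    rw [Int.sign_eq_neg_one_of_neg h0, abs_of_neg h0] at h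
    exact ⟨h0, by omega, by rw [h]; ring⟩
  · left
    rw [Int.sign_eq_one_of_pos h0, abs_of_pos h0] at h
    exact ⟨h0, by omega, by rw [h]; ring⟩

lemma pairInv_apply_phiMap (hw : IsSignedPerm n w)
    (hcomp : ∀ i : ℤ, 1 ≤ i → i ≤ (n : ℤ) →
      wt (phiMap k1 k2 i) = Int.sign (w i) * phiMap k1 k2 |w i|) {i j : ℤ} (hi1 : 1 ≤ i)
    (hi : i ≤ n) (hj1 : 1 ≤ j) (hj : j ≤ n) :
    pairInv (wt (phiMap k1 k2 i)) (wt (phiMap k1 k2 j)) = pairInv (w i) (w j) := by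
  have key : ∀ a b : ℤ, 1 ≤ a → 1 ≤ b →
      ((phiMap k1 k2 b).natAbs < (phiMap k1 k2 a).natAbs ↔ b.natAbs < a.natAbs) := by
    intro a b ha hb
    have h1 := (phiMap_strictMono k1 k2).lt_iff_lt (a := b) (b := a)
    have h2 := one_le_phiMap (k1 := k1) (k2 := k2) ha
    have h3 := one_le_phiMap (k1 := k1) (k2 := k2) hb
    omega
  have hneg : ∀ a : ℤ, 1 ≤ a → 0 < phiMap k1 k2 a := fun a ha => one_le_phiMap ha
  rcases apply_phiMap_cases hw hcomp hi1 hi with ⟨a1, -, a3⟩ | ⟨a1, -, a3⟩ <;>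
  rcases apply_phiMap_cases hw hcomp hj1 hj with ⟨b1, -, b3⟩ | ⟨b1, -, b3⟩ <;>
  rw [a3, b3] <;>
  simp only [pairInv, Int.natAbs_neg]
  · have := key _ _ a1 b1
    have := hneg _ a1
    split_ifs <;> omega
  · have := key (w i) (-w j) a1 (by omega)
    have := hneg _ a1
    split_ifs <;> omega
  · have := key (-w i) (w j) (by omega) b1
    have := hneg (-w i) (by omega)
    split_ifs <;> omega
  · have := key (-w i) (-w j) (by omega) (by omega)
    have := hneg (-w i) (by omega)
    split_ifs <;> omega

lemma apply_apply_phiMap {m : ℕ} (hw : IsSignedPerm n w) (hinv : w * w = 1)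
    (hwt : IsSignedPerm m wt) (hcomp : ∀ i : ℤ, 1 ≤ i → i ≤ (n : ℤ) →
      wt (phiMap k1 k2 i) = Int.sign (w i) * phiMap k1 k2 |w i|) {i : ℤ} (h1 : 1 ≤ i)
    (hi : i ≤ n) : wt (wt (phiMap k1 k2 i)) = phiMap k1 k2 i := by
  have hww : w (w i) = i := by rw [← Equiv.Perm.mul_apply, hinv, Equiv.Perm.one_apply]
  rcases apply_phiMap_cases hw hcomp h1 hi with ⟨a1, a2, a3⟩ | ⟨a1, a2, a3⟩
  · rw [a3]
    rcases apply_phiMap_cases hw hcomp (i := w i) a1 a2 with ⟨b1, -, b3⟩ | ⟨b1, -, -⟩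
    · rw [b3, hww]
    · omega
  · rw [a3, hwt.1]
    rcases apply_phiMap_cases hw hcomp (i := -w i) (by omega) a2 with ⟨b1, -, -⟩ | ⟨-, -, b3⟩
    · rw [hw.1, hww] at b1
      omega
    · rw [b3, hw.1, hww, neg_neg, neg_neg]

end PhiMap

/-! ### The contribution of the two distinguished positions -/

/-- The inversions of `w̃ s_{η_{k₁} + η_{k₂}}` pairing the position `p`, whose image is `v`, with
`k₁` or `k₂`. -/
def crossInv (k1 k2 p v : ℤ) : ℤ :=
  (if p < k1 then pairInv v (-k2) else 0) + (if p < k2 then pairInv v (-k1) else 0)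
    + (if k1 < p then pairInv (-k2) v else 0) + (if k2 < p then pairInv (-k1) v else 0)

/-- The contribution of the position `p`, whose image is `v`, to the closed formula. -/
def crossWeight (k1 k2 p v : ℤ) : ℤ :=
  2 * (if k1 < p ∧ p < k2 then 1 else 0) + 4 * (if p < k1 ∧ v < 0 ∧ -v < k1 then 1 else 0)
    + 4 * (if p < k1 ∧ v < 0 ∧ k1 < -v ∧ -v < k2 then 1 else 0) + 4 * (if k2 < p then 1 else 0)

lemma crossInv_eq_of_lt {k1 k2 p v : ℤ} (hk1 : 1 ≤ k1) (hk12 : k1 < k2) (hp : p < k1)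
    (hv1 : v.natAbs ≠ k1.natAbs) (hv2 : v.natAbs ≠ k2.natAbs) :
    crossInv k1 k2 p v = crossWeight k1 k2 p v +
      if k2 < v.natAbs then 2 else if k1 < v.natAbs then (if v < 0 then -1 else 1) else 0 := by
  have h1 : p < k1 := by omega
  have h2 : p < k2 := by omega
  have h3 : ¬ k1 < p := by omega
  have h4 : ¬ k2 < p := by omega
  simp only [crossInv, crossWeight, pairInv, h1, h2, h3, h4, if_true, if_false, true_and,
    and_true, Int.natAbs_neg]
  split_ifs <;> omega

lemma crossInv_eq_of_mem_Ioo {k1 k2 p v : ℤ} (hk1 : 1 ≤ k1) (hk12 : k1 < k2) (hp1 : k1 < p)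
    (hp2 : p < k2) (hv2 : v.natAbs ≠ k2.natAbs) :
    crossInv k1 k2 p v = crossWeight k1 k2 p v +
      if k2 < v.natAbs then 1 else if k1 < v.natAbs then 0 else if v < 0 then 1 else -1 := by
  have h1 : ¬ p < k1 := by omega
  have h2 : p < k2 := by omega
  have h3 : k1 < p := by omega
  have h4 : ¬ k2 < p := by omega
  simp only [crossInv, crossWeight, pairInv, h1, h2, h3, h4, if_true, if_false, false_and,
    and_true, Int.natAbs_neg]
  split_ifs <;> omega

lemma crossInv_eq_of_gt {k1 k2 p v : ℤ} (hk1 : 1 ≤ k1) (hk12 : k1 < k2) (hp : k2 < p)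
    (hv1 : v.natAbs ≠ k1.natAbs) (hv2 : v.natAbs ≠ k2.natAbs) :
    crossInv k1 k2 p v = crossWeight k1 k2 p v +
      if k2 < v.natAbs then 0 else if k1 < v.natAbs then -1 else -2 := by
  have h1 : ¬ p < k1 := by omega
  have h2 : ¬ p < k2 := by omega
  have h3 : k1 < p := by omega
  have h4 : k2 < p := by omega
  simp only [crossInv, crossWeight, pairInv, h1, h2, h3, h4, if_true, if_false, false_and,
    and_false, Int.natAbs_neg]
  split_ifs <;> omega

/-- The discrepancies at `p` and at `q` cancel if `p` is sent to `v = ±q` and `q` to `u = ±p` with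
the same sign. -/
lemma crossInv_add_crossInv_swap {k1 k2 p q u v : ℤ} (hk1 : 1 ≤ k1) (hk12 : k1 < k2)
    (hp : 1 ≤ p) (hq : 1 ≤ q) (hp1 : p ≠ k1) (hp2 : p ≠ k2) (hq1 : q ≠ k1) (hq2 : q ≠ k2)
    (huv : v = q ∧ u = p ∨ v = -q ∧ u = -p) :
    crossInv k1 k2 p v - crossWeight k1 k2 p v + (crossInv k1 k2 q u - crossWeight k1 k2 q u)
      = 0 := by
  have a2 : v.natAbs ≠ k1.natAbs := by omega
  have a3 : v.natAbs ≠ k2.natAbs := by omega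
  have b2 : u.natAbs ≠ k1.natAbs := by omega
  have b3 : u.natAbs ≠ k2.natAbs := by omega
  have hA := fun x y h => @crossInv_eq_of_lt k1 k2 x y hk1 hk12 h
  have hB := fun x y h h' => @crossInv_eq_of_mem_Ioo k1 k2 x y hk1 hk12 h h'
  have hC := fun x y h => @crossInv_eq_of_gt k1 k2 x y hk1 hk12 h
  have hp3 : p < k1 ∨ (k1 < p ∧ p < k2) ∨ k2 < p := by omega
  have hq3 : q < k1 ∨ (k1 < q ∧ q < k2) ∨ k2 < q := by omega
  rcases hp3 with h | ⟨h, h'⟩ | h <;> rcases hq3 with g | ⟨g, g'⟩ | g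
  · rw [hA p v h a2 a3, hA q u g b2 b3]
    split_ifs <;> omega
  · rw [hA p v h a2 a3, hB q u g g' b3]
    split_ifs <;> omega
  · rw [hA p v h a2 a3, hC q u g b2 b3]
    split_ifs <;> omega
  · rw [hB p v h h' a3, hA q u g b2 b3]
    split_ifs <;> omega
  · rw [hB p v h h' a3, hB q u g g' b3]
    split_ifs <;> omega
  · rw [hB p v h h' a3, hC q u g b2 b3]
    split_ifs <;> omega
  · rw [hC p v h a2 a3, hA q u g b2 b3]
    split_ifs <;> omega
  · rw [hC p v h a2 a3, hB q u g g' b3]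
    split_ifs <;> omega
  · rw [hC p v h a2 a3, hC q u g b2 b3]
    split_ifs <;> omega

section Cross

variable {N : ℕ} {k1 k2 : ℤ} {wt : Equiv.Perm ℤ}

lemma sum_crossInv_eq_sum_crossWeight (hk1 : 1 ≤ k1) (hk12 : k1 < k2)
    (hwt : IsSignedPerm N wt) (hfix1 : wt k1 = k1) (hfix2 : wt k2 = k2)
    (hinv : ∀ p ∈ Finset.Icc (1 : ℤ) N \ {k1, k2}, wt (wt p) = p) :
    ∑ p ∈ Finset.Icc (1 : ℤ) N \ {k1, k2}, crossInv k1 k2 p (wt p) =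
      ∑ p ∈ Finset.Icc (1 : ℤ) N \ {k1, k2}, crossWeight k1 k2 p (wt p) := by
  set S := Finset.Icc (1 : ℤ) N \ {k1, k2} with hS
  have hmem : ∀ p, p ∈ S ↔ (1 ≤ p ∧ p ≤ N) ∧ p ≠ k1 ∧ p ≠ k2 := by
    intro p
    simp only [hS, Finset.mem_sdiff, Finset.mem_Icc, Finset.mem_insert, Finset.mem_singleton,
      not_or, ne_eq]
  have habs : ∀ p ∈ S, ((wt p).natAbs : ℤ) ∈ S := by
    intro p hp
    have hp' := (hmem p).1 hp
    have h0 := hwt.map_ne_zero (i := p) (by omega)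
    have hle := hwt.natAbs_le (i := p) (by omega)
    have h1 := hwt.natAbs_ne (i := p) (j := k1) hp'.2.1 (by omega)
    have h2 := hwt.natAbs_ne (i := p) (j := k2) hp'.2.2 (by omega)
    rw [hfix1] at h1
    rw [hfix2] at h2
    rw [hmem]
    omega
  have habs2 : ∀ p ∈ S, (((wt ((wt p).natAbs : ℤ)).natAbs : ℕ) : ℤ) = p := by
    intro p hp
    have hp' := (hmem p).1 hp
    have h := hinv p hp
    rcases Int.natAbs_eq (wt p) with e | e
    · rw [← e, h]
      omega
    · rw [e, hwt.1] at h
      omega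
  have hreindex : ∑ p ∈ S, (crossInv k1 k2 p (wt p) - crossWeight k1 k2 p (wt p)) =
      ∑ p ∈ S, (crossInv k1 k2 ((wt p).natAbs : ℤ) (wt ((wt p).natAbs : ℤ))
        - crossWeight k1 k2 ((wt p).natAbs : ℤ) (wt ((wt p).natAbs : ℤ))) :=
    Finset.sum_nbij' (fun p => ((wt p).natAbs : ℤ)) (fun p => ((wt p).natAbs : ℤ)) habs habs
      habs2 habs2 fun p hp => by simp only [habs2 p hp]
  have hzero : ∑ p ∈ S, ((crossInv k1 k2 p (wt p) - crossWeight k1 k2 p (wt p))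
      + (crossInv k1 k2 ((wt p).natAbs : ℤ) (wt ((wt p).natAbs : ℤ))
        - crossWeight k1 k2 ((wt p).natAbs : ℤ) (wt ((wt p).natAbs : ℤ)))) = 0 := by
    refine Finset.sum_eq_zero fun p hp => ?_
    have hp' := (hmem p).1 hp
    have hq' := (hmem _).1 (habs p hp)
    have h := hinv p hp
    refine crossInv_add_crossInv_swap hk1 hk12 hp'.1.1 hq'.1.1 hp'.2.1 hp'.2.2 hq'.2.1 hq'.2.2 ?_
    rcases Int.natAbs_eq (wt p) with e | e
    · exact Or.inl ⟨e, by rw [← e, h]⟩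
    · have e' : ((wt p).natAbs : ℤ) = -wt p := by omega
      exact Or.inr ⟨e, by rw [e', hwt.1, h]⟩
  rw [Finset.sum_add_distrib, ← hreindex, Finset.sum_sub_distrib] at hzero
  omega

lemma sum_crossWeight (hk1 : 1 ≤ k1) (hk12 : k1 < k2) (hk2 : k2 ≤ N) :
    ∑ p ∈ Finset.Icc (1 : ℤ) N \ {k1, k2}, crossWeight k1 k2 p (wt p) =
      2 * (k2 - k1 - 1)
        + 4 * ((((Finset.Icc 1 (k1 - 1)).image fun a => wt a) ∩
            ((Finset.Icc 1 (k1 - 1)).image fun a => -a)).card : ℤ)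
        + 4 * ((((Finset.Icc 1 (k1 - 1)).image fun a => wt a) ∩
            ((Finset.Icc (k1 + 1) (k2 - 1)).image fun b => -b)).card : ℤ)
        + 4 * ((Finset.Icc (k2 + 1) (N : ℤ)).card : ℤ) := by
  set S := Finset.Icc (1 : ℤ) N \ {k1, k2} with hS
  have hmem : ∀ p, p ∈ S ↔ (1 ≤ p ∧ p ≤ N) ∧ p ≠ k1 ∧ p ≠ k2 := by
    intro p
    simp only [hS, Finset.mem_sdiff, Finset.mem_Icc, Finset.mem_insert, Finset.mem_singleton,
      not_or, ne_eq]
  have hB : S.filter (fun p => k1 < p ∧ p < k2) = Finset.Icc (k1 + 1) (k2 - 1) := by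
    ext p
    simp only [Finset.mem_filter, hmem, Finset.mem_Icc]
    omega
  have hBcard : ((Finset.Icc (k1 + 1) (k2 - 1)).card : ℤ) = k2 - k1 - 1 := by
    rw [Int.card_Icc]
    omega
  have hC : S.filter (fun p => k2 < p) = Finset.Icc (k2 + 1) (N : ℤ) := by
    ext p
    simp only [Finset.mem_filter, hmem, Finset.mem_Icc]
    omega
  have hAA : ((Finset.Icc 1 (k1 - 1)).image fun a => wt a) ∩
      ((Finset.Icc 1 (k1 - 1)).image fun a => -a) =
      (S.filter fun p => p < k1 ∧ wt p < 0 ∧ -wt p < k1).image wt := by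
    ext x
    simp only [Finset.mem_inter, Finset.mem_image, Finset.mem_filter, hmem, Finset.mem_Icc]
    constructor
    · rintro ⟨⟨a, ha, rfl⟩, b, hb, hab⟩
      exact ⟨a, by omega, rfl⟩
    · rintro ⟨a, ha, rfl⟩
      exact ⟨⟨a, by omega, rfl⟩, -wt a, by omega, by omega⟩
  have hAB : ((Finset.Icc 1 (k1 - 1)).image fun a => wt a) ∩
      ((Finset.Icc (k1 + 1) (k2 - 1)).image fun b => -b) =
      (S.filter fun p => p < k1 ∧ wt p < 0 ∧ k1 < -wt p ∧ -wt p < k2).image wt := by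
    ext x
    simp only [Finset.mem_inter, Finset.mem_image, Finset.mem_filter, hmem, Finset.mem_Icc]
    constructor
    · rintro ⟨⟨a, ha, rfl⟩, b, hb, hab⟩
      exact ⟨a, by omega, rfl⟩
    · rintro ⟨a, ha, rfl⟩
      exact ⟨⟨a, by omega, rfl⟩, -wt a, by omega, by omega⟩
  rw [hAA, hAB, Finset.card_image_of_injective _ wt.injective,
    Finset.card_image_of_injective _ wt.injective, ← hC, ← hBcard, ← hB]
  simp only [crossWeight, Finset.sum_add_distrib, ← Finset.mul_sum, Finset.sum_boole]

lemma dInv_mul_swap_neg (hk1 : 1 ≤ k1) (hk12 : k1 < k2) (hk2 : k2 ≤ N)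
    (hwt : IsSignedPerm N wt) (hfix1 : wt k1 = k1) (hfix2 : wt k2 = k2) :
    dInv N (wt * signedSwap k1 (-k2)) =
      ∑ p ∈ Finset.Icc (1 : ℤ) N \ {k1, k2}, ∑ q ∈ Finset.Icc (1 : ℤ) N \ {k1, k2},
        (if p < q then pairInv (wt p) (wt q) else 0)
      + ∑ p ∈ Finset.Icc (1 : ℤ) N \ {k1, k2}, crossInv k1 k2 p (wt p) + 1 := by
  have hxT : k1 ∈ Finset.Icc (1 : ℤ) N := Finset.mem_Icc.2 ⟨by omega, by omega⟩
  have hyT : k2 ∈ Finset.Icc (1 : ℤ) N := Finset.mem_Icc.2 ⟨by omega, by omega⟩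
  have e1 := hwt.mul_swap_neg_apply_left hk1 hk12
  have e2 := hwt.mul_swap_neg_apply_right hk1 hk12
  rw [hfix2] at e1
  rw [hfix1] at e2
  have e3 : ∀ p ∈ Finset.Icc (1 : ℤ) N \ {k1, k2}, (wt * signedSwap k1 (-k2)) p = wt p := by
    intro p hp
    simp only [Finset.mem_sdiff, Finset.mem_Icc, Finset.mem_insert, Finset.mem_singleton,
      not_or] at hp
    exact mul_swap_neg_apply_of_ne wt hk1 hk12 hp.1.1 hp.2.1 hp.2.2
  unfold dInv
  rw [sum_sum_eq_sdiff_pair _ hxT hyT hk12.ne]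
  congr 1
  · congr 1
    · refine Finset.sum_congr rfl fun p hp => Finset.sum_congr rfl fun q hq => ?_
      rw [e3 p hp, e3 q hq]
    · refine Finset.sum_congr rfl fun p hp => ?_
      rw [e1, e2, e3 p hp, crossInv]
  · rw [e1, e2, if_neg (lt_irrefl _), if_pos hk12, if_neg hk12.not_gt, if_neg (lt_irrefl _),
      pairInv, if_pos (by omega)]
    norm_num

end Cross

lemma sum_sum_pairInv_phiMap {n : ℕ} {k1 k2 : ℤ} (hk1 : 1 ≤ k1) (hk12 : k1 < k2)
    (hk2 : k2 ≤ (n + 2 : ℕ)) {w wt : Equiv.Perm ℤ} (hw : IsSignedPerm n w)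
    (hcomp : ∀ i : ℤ, 1 ≤ i → i ≤ (n : ℤ) →
      wt (phiMap k1 k2 i) = Int.sign (w i) * phiMap k1 k2 |w i|) :
    ∑ p ∈ Finset.Icc (1 : ℤ) (n + 2 : ℕ) \ {k1, k2},
      ∑ q ∈ Finset.Icc (1 : ℤ) (n + 2 : ℕ) \ {k1, k2},
        (if p < q then pairInv (wt p) (wt q) else 0) = dInv n w := by
  rw [← image_phiMap hk1 hk12 hk2, Finset.sum_image (phiMap_strictMono k1 k2).injective.injOn]
  refine Finset.sum_congr rfl fun i hi => ?_
  rw [Finset.sum_image (phiMap_strictMono k1 k2).injective.injOn]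
  refine Finset.sum_congr rfl fun j hj => ?_
  rw [Finset.mem_Icc] at hi hj
  rw [pairInv_apply_phiMap hw hcomp hi.1 hi.2 hj.1 hj.2]
  simp only [(phiMap_strictMono k1 k2).lt_iff_lt]

/-- Let `w ∈ W` (type `Dₙ`) be an involution, let `w̃ ∈ W″` (type
`D_{n+2}`) be the element corresponding to `w` (fixing `k₁, k₂` and acting via the
increasing bijection `φ`), and let `w′ = w̃ ⬝ s_{η_{k₁} + η_{k₂}}`. Then
`ℓ″(w′) = 2(k₂ - k₁ - 1) + 4|w̃(A) ∩ A⁻| + 4|w̃(A) ∩ B⁻| + 4|C| + ℓ(w) + 1`,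
where `A = {1, …, k₁-1}`, `B = {k₁+1, …, k₂-1}`, `C = {k₂+1, …, n+2}`. -/
theorem statement4 (n : ℕ) (hn : 4 ≤ n) (k1 k2 : ℤ)
    (hk1 : 1 ≤ k1) (hk12 : k1 < k2) (hk2 : k2 ≤ (n : ℤ) + 2)
    (w : Equiv.Perm ℤ) (hw : IsD n w) (hinv : w * w = 1)
    (wt : Equiv.Perm ℤ) (hwt : IsD (n + 2) wt)
    (hfix1 : wt k1 = k1) (hfix2 : wt k2 = k2)
    (hcomp : ∀ i : ℤ, 1 ≤ i → i ≤ (n : ℤ) →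
      wt (phiMap k1 k2 i) = Int.sign (w i) * phiMap k1 k2 |w i|) :
    (weylLength (n + 2) (wt * (Equiv.swap k1 (-k2) * Equiv.swap (-k1) k2)) : ℤ)
      = 2 * (k2 - k1 - 1)
        + 4 * ((((Finset.Icc 1 (k1 - 1)).image fun a => wt a) ∩
            ((Finset.Icc 1 (k1 - 1)).image fun a => -a)).card : ℤ)
        + 4 * ((((Finset.Icc 1 (k1 - 1)).image fun a => wt a) ∩
            ((Finset.Icc (k1 + 1) (k2 - 1)).image fun b => -b)).card : ℤ)
        + 4 * ((Finset.Icc (k2 + 1) ((n : ℤ) + 2)).card : ℤ)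
        + (weylLength n w : ℤ) + 1 := by
  have hk2' : k2 ≤ (n + 2 : ℕ) := by omega
  have hswap : Equiv.swap k1 (-k2) * Equiv.swap (-k1) k2 = signedSwap k1 (-k2) := by
    simp [signedSwap]
  have hinv' : ∀ p ∈ Finset.Icc (1 : ℤ) (n + 2 : ℕ) \ {k1, k2}, wt (wt p) = p := by
    intro p hp
    rw [← image_phiMap hk1 hk12 hk2', Finset.mem_image] at hp
    obtain ⟨i, hi, rfl⟩ := hp
    rw [Finset.mem_Icc] at hi
    exact apply_apply_phiMap hw.isSignedPerm hinv hwt.isSignedPerm hcomp hi.1 hi.2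
  have hcast : (n : ℤ) + 2 = (n + 2 : ℕ) := by push_cast; rfl
  rw [hswap, (hwt.mul_swap_neg hk1 hk12 hk2').weylLength_eq (by omega),
    hw.weylLength_eq (by omega),
    dInv_mul_swap_neg hk1 hk12 hk2' hwt.isSignedPerm hfix1 hfix2,
    sum_sum_pairInv_phiMap hk1 hk12 hk2' hw.isSignedPerm hcomp,
    sum_crossInv_eq_sum_crossWeight hk1 hk12 hwt.isSignedPerm hfix1 hfix2 hinv',
    sum_crossWeight hk1 hk12 hk2', hcast]
  ring
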